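/- arXiv:2310.08125 — 6 statements merged into one kernel-verified Lean document; each statement's English description precedes it below -/
import Mathlib

section
/- Let k be an infinite field, let N be a natural number, and let S and T be disjoint finite subsets of k^N. Then there exists a multivariate polynomial P in N variables over k of total degree at most |T| + 1 such that: P evaluates to 0 at every point of T; P evaluates to a nonzero value at every point of S; and the evaluation of P is injective on S. -/
/-- Over an infinite field, some linear functional separates the points of a finite set. -/
theorem Module.exists_dual_injOn {k V : Type*} [Field k] [Infinite k] [AddCommGroup V]
    [Module k V] (A : Finset V) : ∃ f : Module.Dual k V, Set.InjOn f (A : Set V) := by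
  classical
  obtain ⟨f, hf⟩ := Module.exists_dual_forall_apply_ne_zero (K := k)
    (fun p : A.offDiag ↦ p.1.1 - p.1.2)
    (fun p ↦ sub_ne_zero.2 (Finset.mem_offDiag.1 p.2).2.2)
  refine ⟨f, fun x hx y hy hxy ↦ by_contra fun hne ↦ ?_⟩
  exact hf ⟨(x, y), Finset.mem_offDiag.2 ⟨hx, hy, hne⟩⟩ (by simp [hxy])

/-- A linear functional on `k^σ` is evaluation of a polynomial of total degree at most one. -/
theorem MvPolynomial.exists_totalDegree_le_one_eval_eq {k σ : Type*} [Field k] [Fintype σ]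
    (f : Module.Dual k (σ → k)) :
    ∃ L : MvPolynomial σ k, L.totalDegree ≤ 1 ∧ ∀ x, eval x L = f x := by
  classical
  refine ⟨∑ i, C (f fun j ↦ if i = j then 1 else 0) * X i, totalDegree_finsetSum_le fun i _ ↦ ?_, fun x ↦ ?_⟩
  · refine (totalDegree_mul _ _).trans ?_
    simp
  · rw [LinearMap.pi_apply_eq_sum_univ f x]
    simp [mul_comm]

/-- Given functions `q` and `l` on a finite set with `q` nonvanishing and `l` injective,
some `q * (l - c)` is both nonvanishing and injective. -/
theorem Finset.exists_mul_sub_ne_zero_injOn {k α : Type*} [Field k] [Infinite k]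
    (S : Finset α) (q l : α → k) (hq : ∀ s ∈ S, q s ≠ 0) (hl : Set.InjOn l (S : Set α)) :
    ∃ c : k, (∀ s ∈ S, q s * (l s - c) ≠ 0) ∧
      Set.InjOn (fun s ↦ q s * (l s - c)) (S : Set α) := by
  classical
  obtain ⟨c, hc⟩ := Infinite.exists_notMem_finset (S.image l ∪
    (S ×ˢ S).image fun p ↦ (q p.1 * l p.1 - q p.2 * l p.2) / (q p.1 - q p.2))
  rw [Finset.mem_union, not_or] at hc
  refine ⟨c, fun s hs ↦ mul_ne_zero (hq s hs) (sub_ne_zero.2 fun h ↦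
    hc.1 (Finset.mem_image.2 ⟨s, hs, h⟩)), fun s hs s' hs' h ↦ ?_⟩
  by_cases hqq : q s = q s'
  · simp only [hqq] at h
    exact hl hs hs' (sub_left_injective (mul_left_cancel₀ (hq s' hs') h))
  · refine (hc.2 (Finset.mem_image.2 ⟨(s, s'), Finset.mem_product.2 ⟨hs, hs'⟩, ?_⟩)).elim
    rw [div_eq_iff (sub_ne_zero.2 hqq)]
    linear_combination h


/-- **Lemma 2.2 (second claim, rational-point case, nonemptiness).**
Let `k` be an infinite field, `N : ℕ`, and `S, T` disjoint finite subsets of `k^N`.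
Then there is a multivariate polynomial `P` of total degree at most `|T| + 1`
vanishing on `T`, nonvanishing on `S`, and injective on `S`. -/
theorem exists_mvPolynomial_vanishing_injOn
    (k : Type*) [Field k] [Infinite k] (N : ℕ)
    (S T : Finset (Fin N → k)) (hST : Disjoint S T) :
    ∃ P : MvPolynomial (Fin N) k,
      P.totalDegree ≤ T.card + 1 ∧
      (∀ t ∈ T, MvPolynomial.eval t P = 0) ∧
      (∀ s ∈ S, MvPolynomial.eval s P ≠ 0) ∧
      (∀ s ∈ S, ∀ s' ∈ S, s ≠ s' →
        MvPolynomial.eval s P ≠ MvPolynomial.eval s' P) := by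
  classical
  obtain ⟨f, hf⟩ := Module.exists_dual_injOn (k := k) (S ∪ T)
  obtain ⟨L, hL, hLf⟩ := MvPolynomial.exists_totalDegree_le_one_eval_eq f
  let Q : MvPolynomial (Fin N) k := ∏ t ∈ T, (L - MvPolynomial.C (f t))
  have hQ (x) : MvPolynomial.eval x Q = ∏ t ∈ T, (f x - f t) := by
    simp [Q, hLf]
  have hQdeg : Q.totalDegree ≤ T.card := by
    refine (MvPolynomial.totalDegree_finsetProd _ _).trans ?_
    simpa using Finset.sum_le_card_nsmul T _ 1
      fun t _ ↦ (MvPolynomial.totalDegree_sub_C_le L (f t)).trans hL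
  have hQS (s) (hs : s ∈ S) : MvPolynomial.eval s Q ≠ 0 := by
    rw [hQ, Finset.prod_ne_zero_iff]
    refine fun t ht ↦ sub_ne_zero.2 fun h ↦ Finset.disjoint_left.1 hST hs ?_
    rwa [hf (by simp [hs]) (by simp [ht]) h]
  obtain ⟨c, hc, hinj⟩ := S.exists_mul_sub_ne_zero_injOn (fun s ↦ MvPolynomial.eval s Q) f hQS
    (hf.mono (by simp))
  have hP (x) : MvPolynomial.eval x (Q * (L - MvPolynomial.C c)) =
      MvPolynomial.eval x Q * (f x - c) := by simp [hLf]
  refine ⟨Q * (L - MvPolynomial.C c), ?_, fun t ht ↦ ?_, fun s hs ↦ ?_, fun s hs s' hs' hne h ↦ ?_⟩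
  · exact (MvPolynomial.totalDegree_mul _ _).trans
      (add_le_add hQdeg ((MvPolynomial.totalDegree_sub_C_le L c).trans hL))
  · rw [hP, hQ, Finset.prod_eq_zero ht (sub_self (f t)), zero_mul]
  · rw [hP]
    exact hc s hs
  · rw [hP, hP] at h
    exact hne (hinj hs hs' h)
end

section
/- Let k be an infinite field, let N be a natural number, let S and T be disjoint finite subsets of k^N, set d = |T| + 1, and let M denote the finite set of multi-indices m : Fin N → ℕ whose entries sum to at most d. For a coefficient tuple c : M → k, write P_c for the polynomial Σ_{m ∈ M} c_m · X^m, and let V_T denote the set of coefficient tuples c : M → k such that P_c evaluates to 0 at every point of T (a k-subspace of the coefficient space). Then there exists a polynomial Φ in variables indexed by M over k such that: Φ does not vanish identically on V_T; and for every c ∈ V_T at which Φ evaluates to a nonzero value, P_c evaluates to a nonzero value at every point of S and the evaluation of P_c is injective on S. -/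
/-- The finite set of multi-indices `m : Fin N →₀ ℕ` whose entries sum to at most `d`. -/
noncomputable def multiIdxLE (N d : ℕ) : Finset (Fin N →₀ ℕ) :=
  (Finset.Iic (Finsupp.equivFunOnFinite.symm fun _ => d)).filter
    (fun m => (m.sum fun _ e => e) ≤ d)

/-- The polynomial `Σ_{m ∈ M} c_m · X^m` determined by a coefficient tuple
`c` on the multi-indices of degree at most `d`. -/
noncomputable def polyOfCoeffs {k : Type*} [CommSemiring k] {N d : ℕ}
    (c : ↥(multiIdxLE N d) → k) : MvPolynomial (Fin N) k :=
  ∑ m ∈ (multiIdxLE N d).attach, MvPolynomial.monomial m.1 (c m)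

open MvPolynomial in
/-- A point outside a finite set is separated from it by a polynomial whose degree is at most
the size of the set. -/
theorem exists_totalDegree_le_card_eval_eq_zero_eval_ne_zero {k σ : Type*} [Field k]
    (T : Finset (σ → k)) (s : σ → k) (hs : s ∉ T) :
    ∃ p : MvPolynomial σ k,
      p.totalDegree ≤ T.card ∧ (∀ t ∈ T, eval t p = 0) ∧ eval s p ≠ 0 := by
  have hne (t : T) : ∃ i, s i ≠ t.1 i :=
    Function.ne_iff.mp fun h => hs (h ▸ t.2)
  choose i hi using hne
  refine ⟨∏ t ∈ T.attach, (X (i t) - C (t.1 (i t))), ?_, fun t ht => ?_, ?_⟩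
  · refine (totalDegree_finsetProd _ _).trans ?_
    refine (Finset.sum_le_card_nsmul _ _ 1 fun t _ => ?_).trans (by simp)
    exact (totalDegree_sub_C_le _ _).trans (totalDegree_X _).le
  · rw [map_prod]
    exact Finset.prod_eq_zero (Finset.mem_attach T ⟨t, ht⟩) (by simp)
  · rw [map_prod]
    exact Finset.prod_ne_zero_iff.mpr fun t _ => by simpa [sub_eq_zero] using hi t

theorem mem_multiIdxLE {N d : ℕ} {m : Fin N →₀ ℕ} :
    m ∈ multiIdxLE N d ↔ (m.sum fun _ e => e) ≤ d := by
  simp only [multiIdxLE, Finset.mem_filter, Finset.mem_Iic, and_iff_right_iff_imp]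
  intro h i
  exact (Finsupp.le_degree i m).trans h

theorem polyOfCoeffs_coeff {k : Type*} [CommSemiring k] {N d : ℕ}
    {p : MvPolynomial (Fin N) k} (hp : p.totalDegree ≤ d) :
    polyOfCoeffs (fun m : multiIdxLE N d => p.coeff m.1) = p := by
  unfold polyOfCoeffs
  rw [Finset.sum_attach (multiIdxLE N d) fun m => MvPolynomial.monomial m (p.coeff m)]
  conv_rhs => rw [p.as_sum]
  refine (Finset.sum_subset (fun m hm => ?_) fun m _ hm => ?_).symm
  · exact mem_multiIdxLE.mpr ((MvPolynomial.le_totalDegree hm).trans hp)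
  · rw [MvPolynomial.notMem_support_iff.mp hm, map_zero]

/-- Evaluation at `x` of the polynomial with given coefficients, as a linear form in the
coefficients. -/
noncomputable def evalPolyOfCoeffs {k : Type*} [CommSemiring k] {N : ℕ} (d : ℕ)
    (x : Fin N → k) : (multiIdxLE N d → k) →ₗ[k] k where
  toFun c := MvPolynomial.eval x (polyOfCoeffs c)
  map_add' c c' := by simp [polyOfCoeffs, Finset.sum_add_distrib]
  map_smul' a c := by simp [polyOfCoeffs, MvPolynomial.eval_monomial, Finset.mul_sum, mul_assoc]

theorem evalPolyOfCoeffs_apply {k : Type*} [CommSemiring k] {N d : ℕ}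
    (x : Fin N → k) (c : multiIdxLE N d → k) :
    evalPolyOfCoeffs d x c = MvPolynomial.eval x (polyOfCoeffs c) := rfl

/-- A linear form on a finite coordinate space is evaluation of a polynomial. -/
theorem LinearMap.exists_mvPolynomial_eval_eq {k ι : Type*} [CommSemiring k] [Finite ι]
    (f : (ι → k) →ₗ[k] k) :
    ∃ Φ : MvPolynomial ι k, ∀ c, MvPolynomial.eval c Φ = f c := by
  classical
  have := Fintype.ofFinite ι
  refine ⟨∑ i, MvPolynomial.X i * MvPolynomial.C (f fun j => if i = j then 1 else 0),
    fun c => ?_⟩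
  simp [f.pi_apply_eq_sum_univ c]

/-- Finitely many linear forms, none vanishing on a subspace, are detected simultaneously
by one polynomial that does not vanish on that subspace. -/
theorem Submodule.exists_mvPolynomial_eval_ne_zero {k ι κ : Type*} [Field k] [Infinite k]
    [Finite ι] [Finite κ] (V : Submodule k (ι → k)) (f : κ → (ι → k) →ₗ[k] k)
    (hf : ∀ j, ∃ v ∈ V, f j v ≠ 0) :
    ∃ Φ : MvPolynomial ι k, (∃ v ∈ V, MvPolynomial.eval v Φ ≠ 0) ∧
      ∀ v, MvPolynomial.eval v Φ ≠ 0 → ∀ j, f j v ≠ 0 := by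
  have := Fintype.ofFinite κ
  choose L hL using fun j => (f j).exists_mvPolynomial_eval_eq
  have key (v : ι → k) : MvPolynomial.eval v (∏ j, L j) ≠ 0 ↔ ∀ j, f j v ≠ 0 := by
    simp [map_prod, Finset.prod_ne_zero_iff, hL]
  refine ⟨∏ j, L j, ?_, fun v => (key v).mp⟩
  simp only [key]
  exact Module.Dual.exists_forall_mem_ne_zero_of_forall_exists V f hf

/-- **Density assertion of Lemma 2.2 (rational-point case).**
Among coefficient tuples `c` (of degree `≤ |T| + 1`) whose polynomial `P_c` vanishes
on `T` (the subspace `V_T`), there is a polynomial `Φ` in the coefficients which does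
not vanish identically on `V_T`, and whose nonvanishing at `c ∈ V_T` guarantees that
`P_c` is nonvanishing and injective on `S`. -/
theorem exists_detecting_polynomial_on_vanishing_subspace
    (k : Type*) [Field k] [Infinite k] (N : ℕ)
    (S T : Finset (Fin N → k)) (hST : Disjoint S T) :
    ∃ Φ : MvPolynomial ↥(multiIdxLE N (T.card + 1)) k,
      (∃ c : ↥(multiIdxLE N (T.card + 1)) → k,
        (∀ t ∈ T, MvPolynomial.eval t (polyOfCoeffs c) = 0) ∧
        MvPolynomial.eval c Φ ≠ 0) ∧
      (∀ c : ↥(multiIdxLE N (T.card + 1)) → k,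
        (∀ t ∈ T, MvPolynomial.eval t (polyOfCoeffs c) = 0) →
        MvPolynomial.eval c Φ ≠ 0 →
          (∀ s ∈ S, MvPolynomial.eval s (polyOfCoeffs c) ≠ 0) ∧
          (∀ s ∈ S, ∀ s' ∈ S,
            MvPolynomial.eval s (polyOfCoeffs c) =
              MvPolynomial.eval s' (polyOfCoeffs c) → s = s')) := by
  classical
  set d := T.card + 1
  let V : Submodule k (multiIdxLE N d → k) :=
    ⨅ t ∈ T, LinearMap.ker (evalPolyOfCoeffs d t)
  have hV (c : multiIdxLE N d → k) :
      c ∈ V ↔ ∀ t ∈ T, MvPolynomial.eval t (polyOfCoeffs c) = 0 := by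
    simp [V, Submodule.mem_iInf, evalPolyOfCoeffs_apply]
  have hsep (U : Finset (Fin N → k)) (hTU : T ⊆ U) (hU : U.card ≤ d) (s : Fin N → k)
      (hs : s ∉ U) : ∃ c ∈ V, (∀ u ∈ U, evalPolyOfCoeffs d u c = 0) ∧
        evalPolyOfCoeffs d s c ≠ 0 := by
    obtain ⟨p, hp, hpU, hps⟩ := exists_totalDegree_le_card_eval_eq_zero_eval_ne_zero U s hs
    have hpc := polyOfCoeffs_coeff (hp.trans hU)
    refine ⟨fun m => p.coeff m.1, (hV _).mpr ?_, ?_, ?_⟩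
    · simpa only [hpc] using fun t ht => hpU t (hTU ht)
    · simpa only [evalPolyOfCoeffs_apply, hpc] using hpU
    · simpa only [evalPolyOfCoeffs_apply, hpc] using hps
  have hS {s : Fin N → k} (hs : s ∈ S) : s ∉ T := Finset.disjoint_left.mp hST hs
  let f : S ⊕ S.offDiag → (multiIdxLE N d → k) →ₗ[k] k :=
    Sum.elim (fun s => evalPolyOfCoeffs d s.1)
      (fun q => evalPolyOfCoeffs d q.1.1 - evalPolyOfCoeffs d q.1.2)
  have hf (j : S ⊕ S.offDiag) : ∃ c ∈ V, f j c ≠ 0 := by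
    rcases j with ⟨s, hs⟩ | ⟨⟨s, s'⟩, hq⟩
    · obtain ⟨c, hc, -, hcs⟩ := hsep T subset_rfl (Nat.le_succ _) s (hS hs)
      exact ⟨c, hc, hcs⟩
    · obtain ⟨hs, -, hne⟩ := Finset.mem_offDiag.mp hq
      obtain ⟨c, hc, hcU, hcs⟩ := hsep (insert s' T) (Finset.subset_insert _ _)
        (Finset.card_insert_le _ _) s (by simp [hne, hS hs])
      refine ⟨c, hc, ?_⟩
      simpa [f, hcU s' (Finset.mem_insert_self _ _)] using hcs
  obtain ⟨Φ, ⟨c, hc, hΦc⟩, hΦ⟩ := V.exists_mvPolynomial_eval_ne_zero f hf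
  refine ⟨Φ, ⟨c, (hV c).mp hc, hΦc⟩, fun c _ hc => ⟨fun s hs => ?_, fun s hs s' hs' h => ?_⟩⟩
  · exact hΦ c hc (.inl ⟨s, hs⟩)
  · by_contra hne
    exact hΦ c hc (.inr ⟨(s, s'), Finset.mem_offDiag.mpr ⟨hs, hs', hne⟩⟩) (sub_eq_zero.mpr h)
end

section
/- Let k be an infinite field of characteristic different from 2, let N be a natural number, let σ be a k-linear involution of k^N, let x ∈ k^N satisfy σ(x) = x, and let S be a finite subset of k^N not containing x. Then there exists a multivariate polynomial f in N variables over k which is σ-invariant (i.e., its evaluation at σ(y) equals its evaluation at y, for every y ∈ k^N) and such that the evaluation of f at x differs from the evaluation of f at s, for every s ∈ S. -/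
/-- Every linear functional on `ι → R` is the evaluation of a polynomial. -/
lemma MvPolynomial.exists_eval_eq_linearMap {R ι : Type*} [CommSemiring R] [Finite ι]
    (φ : (ι → R) →ₗ[R] R) :
    ∃ p : MvPolynomial ι R, ∀ y : ι → R, MvPolynomial.eval y p = φ y := by
  classical
  have := Fintype.ofFinite ι
  refine ⟨∑ i, MvPolynomial.X i * MvPolynomial.C (φ fun j => if i = j then 1 else 0),
    fun y => ?_⟩
  simp [φ.pi_apply_eq_sum_univ y]

/-- **Lemma 2.3(1), linear-action case.**
Let `k` be an infinite field of characteristic `≠ 2`, `σ` a `k`-linear involution of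
`k^N`, `x` a fixed point of `σ`, and `S` a finite subset of `k^N` not containing `x`.
Then there is a `σ`-invariant polynomial `f` with `f(x) ∉ f(S)`. -/
theorem exists_invariant_polynomial_separating_fixed_point
    (k : Type*) [Field k] [Infinite k] (hchar : ringChar k ≠ 2) (N : ℕ)
    (σ : (Fin N → k) →ₗ[k] (Fin N → k)) (hσ : ∀ y, σ (σ y) = y)
    (x : Fin N → k) (hx : σ x = x)
    (S : Finset (Fin N → k)) (hxS : x ∉ S) :
    ∃ f : MvPolynomial (Fin N) k,
      (∀ y : Fin N → k, MvPolynomial.eval (σ y) f = MvPolynomial.eval y f) ∧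
      (∀ s ∈ S, MvPolynomial.eval x f ≠ MvPolynomial.eval s f) := by
  obtain ⟨φ, hφ⟩ := Module.exists_dual_forall_apply_ne_zero (K := k)
    (Sum.elim (fun s : S => s.1 - x) fun s : S => σ (s.1 - x)) (by
      have hne (s : S) : s.1 - x ≠ 0 := sub_ne_zero.mpr (ne_of_mem_of_not_mem s.2 hxS)
      rintro (s | s)
      · exact hne s
      · intro (h : σ (s.1 - x) = 0)
        exact hne s (by rw [← hσ (s.1 - x), h, map_zero]))
  obtain ⟨p, hp⟩ := MvPolynomial.exists_eval_eq_linearMap φ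
  obtain ⟨q, hq⟩ := MvPolynomial.exists_eval_eq_linearMap (φ.comp σ)
  refine ⟨(p - MvPolynomial.C (φ x)) * (q - MvPolynomial.C (φ x)), fun y => ?_, fun s hs => ?_⟩
  · simp [hp, hq, hσ, mul_comm]
  · have h₁ := hφ (Sum.inl ⟨s, hs⟩)
    have h₂ := hφ (Sum.inr ⟨s, hs⟩)
    simp only [Sum.elim_inl, Sum.elim_inr, map_sub, hx] at h₁ h₂
    simpa [hp, hq] using (mul_ne_zero h₁ h₂).symm
end

section
/- Let k be an infinite field of characteristic different from 2, let N be a natural number, let σ be a k-linear involution of k^N, and let S be a finite subset of k^N such that σ(s) ≠ s for every s ∈ S. Then there exists a multivariate polynomial f in N variables over k which is σ-anti-invariant (i.e., its evaluation at σ(y) equals the negative of its evaluation at y, for every y ∈ k^N) and whose evaluation at every point of S is nonzero. -/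
/-- Every linear form on `ι → R` is the evaluation of a polynomial. -/
lemma MvPolynomial.exists_eval_eq_dual_apply {R ι : Type*} [CommSemiring R] [Fintype ι]
    (φ : Module.Dual R (ι → R)) :
    ∃ f : MvPolynomial ι R, ∀ y, MvPolynomial.eval y f = φ y := by
  classical
  refine ⟨∑ i, MvPolynomial.C (φ (Pi.single i 1)) * MvPolynomial.X i, fun y ↦ ?_⟩
  rw [LinearMap.pi_apply_eq_sum_univ φ y]
  have h (i : ι) : (Pi.single i 1 : ι → R) = fun j ↦ if i = j then 1 else 0 := by
    ext j
    simp [Pi.single_apply, eq_comm]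
  simp [h, mul_comm]

/-- **Lemma 2.3(2), linear-action case.**
Let `k` be an infinite field of characteristic `≠ 2`, `σ` a `k`-linear involution of
`k^N`, and `S` a finite subset of `k^N` containing no fixed point of `σ`.
Then there is a `σ`-anti-invariant polynomial `f` nonvanishing on `S`. -/
theorem exists_antiinvariant_polynomial_nonvanishing
    (k : Type*) [Field k] [Infinite k] (hchar : ringChar k ≠ 2) (N : ℕ)
    (σ : (Fin N → k) →ₗ[k] (Fin N → k)) (hσ : ∀ y, σ (σ y) = y)
    (S : Finset (Fin N → k)) (hS : ∀ s ∈ S, σ s ≠ s) :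
    ∃ f : MvPolynomial (Fin N) k,
      (∀ y : Fin N → k, MvPolynomial.eval (σ y) f = - MvPolynomial.eval y f) ∧
      (∀ s ∈ S, MvPolynomial.eval s f ≠ 0) := by
  obtain ⟨φ, hφ⟩ := Module.exists_dual_forall_apply_ne_zero (K := k)
    (fun s : S ↦ σ s - s) fun s ↦ sub_ne_zero.mpr (hS s s.2)
  obtain ⟨f, hf⟩ := MvPolynomial.exists_eval_eq_dual_apply (φ ∘ₗ (σ - LinearMap.id))
  refine ⟨f, fun y ↦ ?_, fun s hs ↦ ?_⟩
  · simp [hf, hσ]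
  · simpa [hf] using hφ ⟨s, hs⟩
end

section
/- Let k be an infinite field of characteristic different from 2, let N be a natural number, let σ be a k-linear involution of k^N, let S be a finite subset of k^N such that σ(s) ≠ s for every s ∈ S, and let T be a finite subset of k^N with σ(T) = T and T disjoint from S ∪ σ(S). Then there exists a multivariate polynomial f in N variables over k which is σ-anti-invariant (i.e., its evaluation at σ(y) equals the negative of its evaluation at y, for every y ∈ k^N), which evaluates to 0 at every point of T, and whose evaluation at every point of S is nonzero. -/
/-- Over a field, any values on a finite set of points are interpolated by a polynomial. -/
theorem MvPolynomial.exists_eval_eq_of_finset {ι k : Type*} [Field k] (A : Finset (ι → k))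
    (v : (ι → k) → k) : ∃ g : MvPolynomial ι k, ∀ a ∈ A, eval a g = v a := by
  classical
  have sep : ∀ a b : ι → k, ∃ p : MvPolynomial ι k, a ≠ b → eval a p = 1 ∧ eval b p = 0 := by
    intro a b
    by_cases h : a = b
    · exact ⟨0, fun h' => absurd h h'⟩
    · obtain ⟨i, hi⟩ := Function.ne_iff.mp h
      refine ⟨C (a i - b i)⁻¹ * (X i - C (b i)), fun _ => ⟨?_, by simp⟩⟩
      simp [inv_mul_cancel₀ (sub_ne_zero.mpr hi)]
  choose p hp using sep
  refine ⟨∑ b ∈ A, C (v b) * ∏ c ∈ A.erase b, p b c, fun a ha => ?_⟩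
  rw [map_sum, Finset.sum_eq_single_of_mem a ha]
  · rw [map_mul, eval_C, map_prod, Finset.prod_eq_one, mul_one]
    exact fun c hc => (hp a c (Finset.ne_of_mem_erase hc).symm).1
  · intro b _ hba
    rw [map_mul, map_prod, Finset.prod_eq_zero (Finset.mem_erase.mpr ⟨hba.symm, ha⟩) (hp b a hba).2,
      mul_zero]

/-- Polynomial functions are stable under precomposition with linear maps. -/
theorem MvPolynomial.exists_eval_comp_linearMap {ι κ k : Type*} [CommRing k] [Fintype ι]
    [Finite κ] (σ : (ι → k) →ₗ[k] (κ → k)) (g : MvPolynomial κ k) :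
    ∃ g' : MvPolynomial ι k, ∀ y, eval y g' = eval (σ y) g := by
  classical
  have := Fintype.ofFinite κ
  refine ⟨bind₁ (fun i => (LinearMap.toMatrix' σ).toMvPolynomial i) g, fun y => ?_⟩
  rw [← coe_aeval_eq_eval, RingHom.coe_coe, aeval_bind₁, ← coe_aeval_eq_eval, RingHom.coe_coe]
  congr 2
  funext i
  rw [← RingHom.coe_coe, coe_aeval_eq_eval, Matrix.toMvPolynomial_eval_eq_apply,
    LinearMap.toMatrix'_mulVec]


/-- **Lemma 2.3(3), linear-action case.**
Let `k` be an infinite field of characteristic `≠ 2`, `σ` a `k`-linear involution of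
`k^N`, `S` a finite subset of `k^N` containing no fixed point of `σ`, and `T` a
`σ`-invariant finite subset of `k^N` disjoint from `S ∪ σ(S)`.
Then there is a `σ`-anti-invariant polynomial `f` vanishing on `T` and
nonvanishing on `S`. -/
theorem exists_antiinvariant_polynomial_vanishing_nonvanishing
    (k : Type*) [Field k] [Infinite k] (hchar : ringChar k ≠ 2) (N : ℕ)
    (σ : (Fin N → k) →ₗ[k] (Fin N → k)) (hσ : ∀ y, σ (σ y) = y)
    (S T : Finset (Fin N → k)) (hS : ∀ s ∈ S, σ s ≠ s)
    (hT : σ '' (T : Set (Fin N → k)) = (T : Set (Fin N → k)))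
    (hdisj : Disjoint (T : Set (Fin N → k))
      ((S : Set (Fin N → k)) ∪ σ '' (S : Set (Fin N → k)))) :
    ∃ f : MvPolynomial (Fin N) k,
      (∀ y : Fin N → k, MvPolynomial.eval (σ y) f = - MvPolynomial.eval y f) ∧
      (∀ t ∈ T, MvPolynomial.eval t f = 0) ∧
      (∀ s ∈ S, MvPolynomial.eval s f ≠ 0) := by
  classical
  have hTσ : ∀ t ∈ T, σ t ∈ T := fun t ht => by
    have : σ t ∈ σ '' (T : Set (Fin N → k)) := ⟨t, ht, rfl⟩
    rw [hT] at this
    exact this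
  have hST : ∀ s ∈ S, s ∉ T := fun s hs ht => Set.disjoint_left.mp hdisj ht (Or.inl hs)
  have hσST : ∀ s ∈ S, σ s ∉ T := fun s hs ht =>
    Set.disjoint_left.mp hdisj ht (Or.inr ⟨s, hs, rfl⟩)
  -- A well-order selects exactly one point of each free orbit.
  obtain ⟨g, hg⟩ := MvPolynomial.exists_eval_eq_of_finset (T ∪ (S ∪ S.image σ))
    (fun y => if y ∉ T ∧ WellOrderingRel y (σ y) then 1 else 0)
  obtain ⟨g', hg'⟩ := MvPolynomial.exists_eval_comp_linearMap σ g
  refine ⟨g - g', fun y => ?_, fun t ht => ?_, fun s hs => ?_⟩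
  · simp [hg', hσ]
  · rw [map_sub, hg', hg t (by simp [ht]), hg (σ t) (by simp [hTσ t ht])]
    simp [ht, hTσ t ht]
  · have hσs : σ s ∈ S.image σ := Finset.mem_image_of_mem σ hs
    rw [map_sub, hg', hg s (by simp [hs]),
      hg (σ s) (Finset.mem_union_right _ (Finset.mem_union_right _ hσs)), hσ]
    rcases trichotomous_of WellOrderingRel s (σ s) with h | h | h
    · simp [hST s hs, h, asymm_of WellOrderingRel h]
    · exact absurd h.symm (hS s hs)
    · simp [hσST s hs, h, asymm_of WellOrderingRel h]
end

section
/- Let R be a commutative Noetherian ring in which 2 is a unit, and let σ be a ring automorphism of R with σ ∘ σ = id. Let R₊ denote the subring of σ-fixed elements, and assume R is finitely generated as a module over R₊. Let m be a maximal ideal of R such that σ(a) − a ∈ m for every a ∈ R, and σ(a) − a ∈ m² for every a ∈ m. Then σ induces the identity on the localization of R at m: for every r ∈ R, the images of r and of σ(r) under the localization map R → Localization.AtPrime m coincide. -/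
/-- The subring of elements fixed by a ring involution `σ`. -/
def fixedSubring {R : Type*} [CommRing R] (σ : R ≃+* R) : Subring R where
  carrier := {r | σ r = r}
  zero_mem' := by simp
  one_mem' := by simp
  add_mem' := by intro a b ha hb; simp only [Set.mem_setOf_eq, map_add] at *; rw [ha, hb]
  mul_mem' := by intro a b ha hb; simp only [Set.mem_setOf_eq, map_mul] at *; rw [ha, hb]
  neg_mem' := by intro a ha; simp only [Set.mem_setOf_eq, map_neg] at *; rw [ha]

/-- If a ring endomorphism `σ` maps `m` into itself, then `σ - 1` maps `m ^ 2` into `m * I` for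
every ideal `I` containing the image of `σ - 1`. -/
theorem map_sub_self_mem_mul_of_mem_sq {R : Type*} [CommRing R] (σ : R →+* R) {m I : Ideal R}
    (hm : ∀ a ∈ m, σ a ∈ m) (hI : ∀ a, σ a - a ∈ I) {y : R} (hy : y ∈ m ^ 2) :
    σ y - y ∈ m * I := by
  rw [pow_two] at hy
  induction hy using Submodule.mul_induction_on' with
  | mem_mul_mem u hu v hv =>
    have h : σ (u * v) - u * v = σ u * (σ v - v) + v * (σ u - u) := by
      rw [map_mul]; ring
    rw [h]
    exact add_mem (Ideal.mul_mem_mul (hm u hu) (hI v)) (Ideal.mul_mem_mul hv (hI u))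
  | add x _ y _ hx hy =>
    have h : σ (x + y) - (x + y) = (σ x - x) + (σ y - y) := by
      rw [map_add]; ring
    rw [h]
    exact add_mem hx hy

/-- **Footnoted claim in Theorem 2.1.**
Let `R` be a commutative Noetherian ring in which `2` is a unit, `σ` a ring involution
of `R` such that `R` is finite over the fixed subring `R₊`. If `m` is a maximal ideal
such that `σ` is trivial modulo `m` and trivial on `m` modulo `m²`, then `σ` induces
the identity on the localization of `R` at `m`. -/
theorem involution_trivial_on_localization
    (R : Type*) [CommRing R] [IsNoetherianRing R] (h2 : IsUnit (2 : R))
    (σ : R ≃+* R) (hσ : ∀ r, σ (σ r) = r)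
    (hfin : Module.Finite (fixedSubring σ) R)
    (m : Ideal R) [hm : m.IsMaximal]
    (hres : ∀ a : R, σ a - a ∈ m)
    (hcot : ∀ a ∈ m, σ a - a ∈ m ^ 2) :
    ∀ r : R, algebraMap R (Localization.AtPrime m) r =
      algebraMap R (Localization.AtPrime m) (σ r) := by
  let I : Ideal R := Ideal.span (Set.range fun a => σ a - a)
  have hI (a : R) : σ a - a ∈ I := Ideal.subset_span ⟨a, rfl⟩
  have hσm (a : R) (ha : a ∈ m) : σ a ∈ m := by simpa using add_mem (hres a) ha
  have anti (a : R) : σ (σ a - a) - (σ a - a) = -2 * (σ a - a) := by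
    rw [map_sub, hσ]; ring
  have hunit : IsUnit (-2 : R) := h2.neg
  have hsq (a : R) : σ a - a ∈ m ^ 2 := by
    have h := hcot _ (hres a)
    rwa [anti, Ideal.unit_mul_mem_iff_mem _ hunit] at h
  have hle : I ≤ m * I := by
    refine Ideal.span_le.mpr ?_
    rintro _ ⟨a, rfl⟩
    have h := map_sub_self_mem_mul_of_mem_sq (σ : R →+* R) hσm hI (hsq a)
    rw [RingEquiv.coe_toRingHom, anti] at h
    exact (Ideal.unit_mul_mem_iff_mem _ hunit).mp h
  obtain ⟨s, hs, hsI⟩ := Submodule.exists_sub_one_mem_and_smul_eq_zero_of_fg_of_le_smul m I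
    (IsNoetherian.noetherian I) hle
  have hsm : s ∉ m := fun h =>
    hm.ne_top ((Ideal.eq_top_iff_one m).mpr (by simpa using sub_mem h hs))
  intro r
  rw [IsLocalization.eq_iff_exists m.primeCompl]
  refine ⟨⟨s, hsm⟩, ?_⟩
  have h : s * (σ r - r) = 0 := hsI _ (hI r)
  exact (sub_eq_zero.mp (by rwa [mul_sub] at h)).symm
end
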